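/- arXiv:2209.10575 — 2 statements merged into one kernel-verified Lean document; each statement's English description precedes it below -/
import Mathlib

section
/- There exists a minimizer of the marginal negative log-likelihood over ℝ^p × S_+^q: there exist β* ∈ ℝ^p and a symmetric positive semidefinite Γ* ∈ ℝ^{q×q} such that L_ML(β*, Γ*) ≤ L_ML(β, Γ) for every β ∈ ℝ^p and every symmetric positive semidefinite Γ ∈ ℝ^{q×q}. -/
open Matrix Real Filter Topology Bornology
open scoped Pointwise

noncomputable section

abbrev Vec (k : ℕ) : Type := Fin k → ℝ

/-- Euclidean norm of a vector. -/
def eNorm {ι : Type*} [Fintype ι] (x : ι → ℝ) : ℝ := Real.sqrt (∑ j, (x j) ^ 2)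

/-- Squared Euclidean norm of a pair of vectors. -/
def sqnorm2 {p q : ℕ} (w : Vec p × Vec q) : ℝ :=
  (∑ j, (w.1 j) ^ 2) + ∑ j, (w.2 j) ^ 2

/-- ℓ²→ℓ² operator norm of a matrix (its largest singular value). -/
def opNorm {ι κ : Type*} [Fintype ι] [Fintype κ] (M : Matrix ι κ ℝ) : ℝ :=
  sInf {c : ℝ | 0 ≤ c ∧ ∀ x : κ → ℝ, eNorm (M.mulVec x) ≤ c * eNorm x}

/-- Smallest eigenvalue of a symmetric matrix, via Rayleigh quotients. -/
def minEig {ι : Type*} [Fintype ι] (M : Matrix ι ι ℝ) : ℝ :=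
  sInf {r : ℝ | ∃ x : ι → ℝ, eNorm x = 1 ∧ r = x ⬝ᵥ M.mulVec x}

/-- Largest eigenvalue of a symmetric matrix, via Rayleigh quotients. -/
def maxEig {ι : Type*} [Fintype ι] (M : Matrix ι ι ℝ) : ℝ :=
  sSup {r : ℝ | ∃ x : ι → ℝ, eNorm x = 1 ∧ r = x ⬝ᵥ M.mulVec x}

/-- The log-barrier (perspective of the negative log). -/
def phiBar (μ : ℝ) {q : ℕ} (γ : Vec q) : EReal :=
  if μ = 0 then (if ∀ j, 0 ≤ γ j then (0 : EReal) else ⊤)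
  else if 0 < μ then
    (if ∀ j, 0 < γ j then (((-μ) * ∑ j, Real.log (γ j / μ) : ℝ) : EReal) else ⊤)
  else ⊤

/-- The coupling function κ_η. -/
def kappaFun (η : ℝ) {p q : ℕ} (w : Vec p × Vec q) : ℝ := η / 2 * sqnorm2 w

/-- 1-coercivity: liminf of F(w)/‖w‖ as ‖w‖ → ∞ is positive. -/
def OneCoercive {p q : ℕ} (R : Vec p × Vec q → EReal) : Prop :=
  ∃ c : ℝ, 0 < c ∧ ∃ r : ℝ, ∀ w : Vec p × Vec q,
    r ≤ Real.sqrt (sqnorm2 w) → ((c * Real.sqrt (sqnorm2 w) : ℝ) : EReal) ≤ R w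

/-- Data of a linear mixed-effects model. -/
structure LMEData (m p q : ℕ) where
  n : Fin m → ℕ
  X : ∀ i, Matrix (Fin (n i)) (Fin p) ℝ
  Z : ∀ i, Matrix (Fin (n i)) (Fin q) ℝ
  y : ∀ i, Fin (n i) → ℝ
  lam : ∀ i, Matrix (Fin (n i)) (Fin (n i)) ℝ

namespace LMEData

variable {m p q : ℕ}

/-- Ω_i(Γ) = Z_i Γ Z_iᵀ + Λ_i. -/
def Omega (D : LMEData m p q) (Γ : Matrix (Fin q) (Fin q) ℝ) (i : Fin m) :
    Matrix (Fin (D.n i)) (Fin (D.n i)) ℝ :=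
  D.Z i * Γ * (D.Z i)ᵀ + D.lam i

/-- The marginal negative log-likelihood L_ML(β, Γ). -/
def LML (D : LMEData m p q) (β : Vec p) (Γ : Matrix (Fin q) (Fin q) ℝ) : ℝ :=
  ∑ i, ((1 : ℝ) / 2 * ((D.y i - D.X i *ᵥ β) ⬝ᵥ ((D.Omega Γ i)⁻¹ *ᵥ (D.y i - D.X i *ᵥ β)))
    + (1 : ℝ) / 2 * Real.log (D.Omega Γ i).det)

/-- L(β, γ) = L_ML(β, Diag γ). -/
def L (D : LMEData m p q) (β : Vec p) (γ : Vec q) : ℝ := D.LML β (Matrix.diagonal γ)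

/-- ν = max_i (1/2) μ_min(Λ_i)^{-2} σ_max(Z_i)^4. -/
def nu (D : LMEData m p q) : ℝ :=
  ⨆ i : Fin m, (1 : ℝ) / 2 * ((minEig (D.lam i)) ^ 2)⁻¹ * (opNorm (D.Z i)) ^ 4

/-- η̄ = ν m. -/
def etabar (D : LMEData m p q) : ℝ := D.nu * m

/-- L_{η,μ}((β,γ),(β̃,γ̃)) = L(β,γ) + φ_μ(γ) + κ_η(β−β̃,γ−γ̃). -/
def Lrelax (D : LMEData m p q) (η μ : ℝ) (x w : Vec p × Vec q) : EReal :=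
  ((D.L x.1 x.2 + kappaFun η (x - w) : ℝ) : EReal) + phiBar μ x.2

/-- The optimal value function u_{η,μ} (with extended-real values). -/
def uval (D : LMEData m p q) (η μ : ℝ) (w : Vec p × Vec q) : EReal :=
  ⨅ x : Vec p × Vec q, D.Lrelax η μ x w

/-- The (real-valued) optimal value function u_{η,μ}. -/
def ufun (D : LMEData m p q) (η μ : ℝ) (w : Vec p × Vec q) : ℝ := (D.uval η μ w).toReal

/-- Partial gradient ∇_β L. -/
def gradB (D : LMEData m p q) (β : Vec p) (γ : Vec q) : Vec p :=
  fun j => fderiv ℝ (fun b => D.L b γ) β (Pi.single j 1)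

/-- Partial gradient ∇_γ L. -/
def gradG (D : LMEData m p q) (β : Vec p) (γ : Vec q) : Vec q :=
  fun j => fderiv ℝ (fun g => D.L β g) γ (Pi.single j 1)

/-- The map G_{η,μ}. -/
def Gmap (D : LMEData m p q) (η μ : ℝ) (x : Vec p × Vec q × Vec q) (w : Vec p × Vec q) :
    Vec p × Vec q × Vec q :=
  (D.gradB x.1 x.2.1 + η • (x.1 - w.1),
   D.gradG x.1 x.2.1 + η • (x.2.1 - w.2) - x.2.2,
   fun j => x.2.2 j * x.2.1 j - μ)

/-- Second-derivative block ∇²_{ββ} L. -/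
def hessBB (D : LMEData m p q) (β : Vec p) (γ : Vec q) : Matrix (Fin p) (Fin p) ℝ :=
  Matrix.of fun j k => fderiv ℝ (fun b => D.gradB b γ j) β (Pi.single k 1)

/-- Second-derivative block ∇²_{γγ} L. -/
def hessGG (D : LMEData m p q) (β : Vec p) (γ : Vec q) : Matrix (Fin q) (Fin q) ℝ :=
  Matrix.of fun j k => fderiv ℝ (fun g => D.gradG β g j) γ (Pi.single k 1)

/-- Second-derivative block ∇²_{γβ} L (the p×q cross block). -/
def hessGB (D : LMEData m p q) (β : Vec p) (γ : Vec q) : Matrix (Fin p) (Fin q) ℝ :=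
  Matrix.of fun j k => fderiv ℝ (fun g => D.gradB β g j) γ (Pi.single k 1)

/-- Second-derivative block ∇²_{βγ} L (the q×p cross block). -/
def hessBG (D : LMEData m p q) (β : Vec p) (γ : Vec q) : Matrix (Fin q) (Fin p) ℝ :=
  Matrix.of fun j k => fderiv ℝ (fun b => D.gradG b γ j) β (Pi.single k 1)

end LMEData

/-- f(r, M) = (1/2)(rᵀM⁻¹r + ln det M). -/
def fRM {n : ℕ} (r : Vec n) (M : Matrix (Fin n) (Fin n) ℝ) : ℝ :=
  (1 : ℝ) / 2 * (r ⬝ᵥ (M⁻¹ *ᵥ r) + Real.log M.det)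

lemma aux_cs {n : ℕ} (Ω : Matrix (Fin n) (Fin n) ℝ) (h : Ω.PosDef) (r : Fin n → ℝ) (j : Fin n) :
    r j ^ 2 ≤ Ω j j * (r ⬝ᵥ (Ω⁻¹ *ᵥ r)) := by
  have hj : 0 < Ω j j := h.diag_pos
  have hu : IsUnit Ω.det := h.det_pos.ne'.isUnit
  set s := Ω⁻¹ *ᵥ r with hs
  have hr : Ω *ᵥ s = r := by
    rw [hs, Matrix.mulVec_mulVec, Matrix.mul_nonsing_inv _ hu, Matrix.one_mulVec]
  have hsym : Ωᵀ = Ω := by simpa using h.isHermitian.eq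
  have key := h.posSemidef.dotProduct_mulVec_nonneg (s - Pi.single j (r j / Ω j j))
  have e1 : s ⬝ᵥ (Ω *ᵥ Pi.single j (r j / Ω j j)) = r j * (r j / Ω j j) := by
    rw [Matrix.dotProduct_mulVec, ← Matrix.mulVec_transpose, hsym, hr]
    simp
  have e2 : (Pi.single j (r j / Ω j j)) ⬝ᵥ (Ω *ᵥ Pi.single j (r j / Ω j j))
      = (r j / Ω j j) * (Ω j j * (r j / Ω j j)) := by
    simp
    ring
  rw [star_trivial, Matrix.mulVec_sub, sub_dotProduct, dotProduct_sub, dotProduct_sub, e1, e2, hr,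
    single_dotProduct, dotProduct_comm s r] at key
  have : r ⬝ᵥ s - r j * (r j / Ω j j) ≥ 0 := by
    have e3 : (r j / Ω j j) * (Ω j j * (r j / Ω j j)) = r j * (r j / Ω j j) := by field_simp
    rw [e3] at key
    linarith
  calc r j ^ 2 = Ω j j * (r j * (r j / Ω j j)) := by field_simp
    _ ≤ _ := mul_le_mul_of_nonneg_left (by linarith) hj.le

lemma aux_lower {n : ℕ} (Λ : Matrix (Fin n) (Fin n) ℝ) (h : Λ.PosDef) :
    ∃ c : ℝ, 0 < c ∧ ∀ x : Fin n → ℝ, c * (x ⬝ᵥ x) ≤ x ⬝ᵥ (Λ *ᵥ x) := by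
  have hu : IsUnit Λ.det := h.det_pos.ne'.isUnit
  have ht : 0 ≤ (Λ⁻¹).trace := h.inv.posSemidef.trace_nonneg
  refine ⟨1 / ((Λ⁻¹).trace + 1), by positivity, fun x => ?_⟩
  have hq : 0 ≤ x ⬝ᵥ (Λ *ᵥ x) := by simpa using h.posSemidef.dotProduct_mulVec_nonneg x
  have h1 : x ⬝ᵥ x ≤ (Λ⁻¹).trace * (x ⬝ᵥ (Λ *ᵥ x)) := by
    rw [Matrix.trace, Finset.sum_mul]
    refine Finset.sum_le_sum fun j _ => ?_
    have := aux_cs Λ⁻¹ h.inv x j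
    rw [Matrix.nonsing_inv_nonsing_inv _ hu] at this
    rw [← sq]
    exact this
  rw [div_mul_eq_mul_div, div_le_iff₀ (by positivity)]
  nlinarith

lemma aux_posdef {n q : ℕ} (Λ : Matrix (Fin n) (Fin n) ℝ) (h : Λ.PosDef)
    (M : Matrix (Fin n) (Fin q) ℝ) : (M * Mᵀ + Λ).PosDef := by
  have := posSemidef_self_mul_conjTranspose M
  rw [conjTranspose_eq_transpose_of_trivial] at this
  exact h.posSemidef_add this

lemma aux_det {n q : ℕ} (Λ : Matrix (Fin n) (Fin n) ℝ) (h : Λ.PosDef) :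
    ∃ c : ℝ, 0 < c ∧ ∀ M : Matrix (Fin n) (Fin q) ℝ,
      c ^ n ≤ (M * Mᵀ + Λ).det ∧
      (M * Mᵀ + Λ).trace ≤ n * ((M * Mᵀ + Λ).det / c ^ (n - 1)) := by
  obtain ⟨c, hc, hcx⟩ := aux_lower Λ h
  refine ⟨c, hc, fun M => ?_⟩
  have hP := aux_posdef Λ h M
  have hA := hP.isHermitian
  have hE : ∀ i, c ≤ hA.eigenvalues i := by
    intro i
    rw [hA.eigenvalues_eq]
    set v : Fin n → ℝ := ⇑(hA.eigenvectorBasis i) with hv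
    have hv1 : v ⬝ᵥ v = 1 := by
      have := hA.eigenvectorBasis.orthonormal.1 i
      have h2 : ‖hA.eigenvectorBasis i‖ ^ 2 = 1 := by rw [this]; norm_num
      rw [EuclideanSpace.real_norm_sq_eq] at h2
      simpa [dotProduct, sq, hv] using h2
    have hM : 0 ≤ v ⬝ᵥ ((M * Mᵀ) *ᵥ v) := by
      have := (posSemidef_self_mul_conjTranspose M).dotProduct_mulVec_nonneg v
      simpa using this
    have h3 := hcx v
    rw [hv1] at h3
    rw [star_trivial, Matrix.add_mulVec, dotProduct_add]
    simp only [RCLike.re_to_real]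
    linarith
  have hdet : (M * Mᵀ + Λ).det = ∏ i, hA.eigenvalues i := by
    simpa using hA.det_eq_prod_eigenvalues
  have htr : (M * Mᵀ + Λ).trace = ∑ i, hA.eigenvalues i := by
    simpa using hA.trace_eq_sum_eigenvalues
  constructor
  · rw [hdet]
    calc c ^ n = ∏ i : Fin n, c := by simp
      _ ≤ _ := Finset.prod_le_prod (fun _ _ => hc.le) fun i _ => hE i
  · rw [htr, hdet]
    calc ∑ i, hA.eigenvalues i
        ≤ ∑ i : Fin n, ((∏ i, hA.eigenvalues i) / c ^ (n - 1)) := by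
          refine Finset.sum_le_sum fun i _ => ?_
          rw [le_div_iff₀ (by positivity), ← Finset.mul_prod_erase Finset.univ _ (Finset.mem_univ i)]
          refine mul_le_mul_of_nonneg_left ?_ (hc.le.trans (hE i))
          calc c ^ (n - 1) = ∏ i ∈ Finset.univ.erase i, c := by
                simp [Finset.card_erase_of_mem]
            _ ≤ _ := Finset.prod_le_prod (fun _ _ => hc.le) fun i _ => hE i
      _ = _ := by simp

/-- One summand of the objective. -/
def auxTerm {n q : ℕ} (Λ : Matrix (Fin n) (Fin n) ℝ) (r : Fin n → ℝ)
    (M : Matrix (Fin n) (Fin q) ℝ) : ℝ :=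
  (1 : ℝ) / 2 * (r ⬝ᵥ ((M * Mᵀ + Λ)⁻¹ *ᵥ r)) + (1 : ℝ) / 2 * Real.log (M * Mᵀ + Λ).det

lemma auxTerm_bdd {n q : ℕ} (Λ : Matrix (Fin n) (Fin n) ℝ) (h : Λ.PosDef) :
    (∃ l : ℝ, ∀ r, ∀ M : Matrix (Fin n) (Fin q) ℝ, l ≤ auxTerm Λ r M) ∧
    ∀ C : ℝ, ∃ K : ℝ, ∀ r, ∀ M : Matrix (Fin n) (Fin q) ℝ, auxTerm Λ r M ≤ C →
      (∀ a, |r a| ≤ K) ∧ ∀ a b, |M a b| ≤ K := by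
  obtain ⟨c, hc, hM⟩ := aux_det (q := q) Λ h
  have hq : ∀ r, ∀ M : Matrix (Fin n) (Fin q) ℝ, 0 ≤ r ⬝ᵥ ((M * Mᵀ + Λ)⁻¹ *ᵥ r) := by
    intro r M
    simpa using (aux_posdef Λ h M).inv.posSemidef.dotProduct_mulVec_nonneg r
  have hl : ∀ M : Matrix (Fin n) (Fin q) ℝ, Real.log (c ^ n) ≤ Real.log (M * Mᵀ + Λ).det :=
    fun M => Real.log_le_log (by positivity) (hM M).1
  refine ⟨⟨1 / 2 * Real.log (c ^ n), fun r M => ?_⟩, fun C => ?_⟩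
  · have := hq r M
    have := hl M
    unfold auxTerm
    linarith
  · set T := n * (Real.exp (2 * C) / c ^ (n - 1)) with hT
    set Q := 2 * C - Real.log (c ^ n) with hQ
    refine ⟨Real.sqrt (T * Q) + Real.sqrt T, fun r M hrM => ?_⟩
    have h1 := hq r M
    have h2 := hl M
    have hP := aux_posdef Λ h M
    unfold auxTerm at hrM
    have hq' : r ⬝ᵥ ((M * Mᵀ + Λ)⁻¹ *ᵥ r) ≤ Q := by linarith
    have hd : (M * Mᵀ + Λ).det ≤ Real.exp (2 * C) := by
      rw [← Real.log_le_iff_le_exp hP.det_pos]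
      linarith
    have ht : (M * Mᵀ + Λ).trace ≤ T := by
      refine (hM M).2.trans ?_
      rw [hT]
      gcongr
    have hdiag : ∀ a, (M * Mᵀ + Λ) a a ≤ T := by
      intro a
      refine le_trans ?_ ht
      exact Finset.single_le_sum (f := fun a => (M * Mᵀ + Λ) a a)
        (fun i _ => (hP.diag_pos (i := i)).le) (Finset.mem_univ a)
    constructor
    · intro a
      have h3 := aux_cs _ hP r a
      have h4 : r a ^ 2 ≤ T * Q := by
        have hp := (hP.diag_pos (i := a)).le
        exact h3.trans (mul_le_mul (hdiag a) hq' h1 (hp.trans (hdiag a)))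
      have := Real.abs_le_sqrt h4
      have := Real.sqrt_nonneg T
      linarith
    · intro a b
      have h5 : M a b ^ 2 ≤ T := by
        refine le_trans ?_ (hdiag a)
        have h6 : (M * Mᵀ) a a = ∑ b, M a b ^ 2 := by
          simp [Matrix.mul_apply, sq]
        rw [Matrix.add_apply, h6]
        have := Finset.single_le_sum (f := fun b => M a b ^ 2) (fun i _ => sq_nonneg _)
          (Finset.mem_univ b)
        have := (h.diag_pos (i := a)).le
        linarith
      have := Real.abs_le_sqrt h5
      have := Real.sqrt_nonneg (T * Q)
      linarith

lemma auxTerm_cont {n q : ℕ} (Λ : Matrix (Fin n) (Fin n) ℝ) (h : Λ.PosDef) {W : Type*}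
    [TopologicalSpace W] (r : W → Fin n → ℝ) (M : W → Matrix (Fin n) (Fin q) ℝ)
    (hr : Continuous r) (hM : Continuous M) : Continuous fun w => auxTerm Λ (r w) (M w) := by
  have hO : Continuous fun w => M w * (M w)ᵀ + Λ := by fun_prop
  have hdet : Continuous fun w => (M w * (M w)ᵀ + Λ).det := hO.matrix_det
  have hne : ∀ w, (M w * (M w)ᵀ + Λ).det ≠ 0 := fun w => (aux_posdef Λ h (M w)).det_pos.ne'
  have hinv : Continuous fun w => (M w * (M w)ᵀ + Λ)⁻¹ := by
    simp only [Matrix.inv_def, Ring.inverse_eq_inv']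
    exact (hdet.inv₀ hne).smul hO.matrix_adjugate
  unfold auxTerm
  refine Continuous.add (continuous_const.mul ?_) (continuous_const.mul (hdet.log hne))
  exact hr.dotProduct (hinv.matrix_mulVec hr)

/-- The linear data map. -/
def auxF {m p q : ℕ} (D : LMEData m p q) : (Vec p × (Fin q → Fin q → ℝ)) →ₗ[ℝ]
    (∀ i, (Fin (D.n i) → ℝ) × (Fin (D.n i) → Fin q → ℝ)) where
  toFun w := fun i => (D.X i *ᵥ w.1, (D.Z i * (Matrix.of w.2) : Matrix _ _ ℝ))
  map_add' a b := by
    funext i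
    refine Prod.ext ?_ ?_
    · exact Matrix.mulVec_add (D.X i) a.1 b.1
    · exact Matrix.mul_add (D.Z i) (Matrix.of a.2) (Matrix.of b.2)
  map_smul' c a := by
    funext i
    refine Prod.ext ?_ ?_
    · exact Matrix.mulVec_smul (D.X i) c a.1
    · exact Matrix.mul_smul (D.Z i) c (Matrix.of a.2)

open scoped MatrixOrder ComplexOrder in
lemma aux_sqrt {q : ℕ} (Γ : Matrix (Fin q) (Fin q) ℝ) (hΓ : Γ.PosSemidef) :
    ∃ B : Fin q → Fin q → ℝ, Γ = Matrix.of B * (Matrix.of B)ᵀ := by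
  obtain ⟨B, hB⟩ := CStarAlgebra.nonneg_iff_eq_star_mul_self.mp hΓ.nonneg
  refine ⟨Bᵀ, ?_⟩
  rw [hB, star_eq_conjTranspose, conjTranspose_eq_transpose_of_trivial]
  rfl

/-- Existence of a minimizer of the marginal negative log-likelihood
over ℝ^p × S_+^q. -/
theorem existence_of_minimizer
    {m p q : ℕ} (hm : 0 < m) (hp : 0 < p) (hq : 0 < q)
    (D : LMEData m p q) (hn : ∀ i, 0 < D.n i) (hlam : ∀ i, (D.lam i).PosDef) :
    ∃ (βs : Vec p) (Γs : Matrix (Fin q) (Fin q) ℝ), Γs.PosSemidef ∧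
      ∀ (β : Vec p) (Γ : Matrix (Fin q) (Fin q) ℝ), Γ.PosSemidef →
        D.LML βs Γs ≤ D.LML β Γ := by
  set h : (∀ i, (Fin (D.n i) → ℝ) × (Fin (D.n i) → Fin q → ℝ)) → ℝ :=
    fun w => ∑ i, auxTerm (D.lam i) (D.y i - (w i).1) (Matrix.of (w i).2) with hh
  have hF : ∀ β (B : Fin q → Fin q → ℝ),
      h (auxF D (β, B)) = D.LML β (Matrix.of B * (Matrix.of B)ᵀ) := by
    intro β B
    simp only [hh, LMEData.LML, auxTerm, LMEData.Omega]
    refine Finset.sum_congr rfl fun i _ => ?_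
    have e : (D.Z i * (Matrix.of B * (Matrix.of B)ᵀ) * (D.Z i)ᵀ : Matrix _ _ ℝ)
        = (D.Z i * Matrix.of B) * (D.Z i * Matrix.of B)ᵀ := by
      rw [Matrix.transpose_mul]
      simp only [Matrix.mul_assoc]
    rw [e]
    rfl
  have hcont : Continuous h := by
    refine continuous_finsetSum _ fun i _ => ?_
    have c1 : Continuous fun w : (∀ i, (Fin (D.n i) → ℝ) × (Fin (D.n i) → Fin q → ℝ)) =>
        D.y i - (w i).1 := continuous_const.sub (continuous_fst.comp (continuous_apply i))
    have c2 : Continuous fun w : (∀ i, (Fin (D.n i) → ℝ) × (Fin (D.n i) → Fin q → ℝ)) =>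
        (w i).2 := continuous_snd.comp (continuous_apply i)
    exact auxTerm_cont (D.lam i) (hlam i) _ _ c1 c2
  choose l hl using fun i => (auxTerm_bdd (q := q) (D.lam i) (hlam i)).1
  choose K hK using fun i => (auxTerm_bdd (q := q) (D.lam i) (hlam i)).2
    (h 0 - ∑ j ∈ Finset.univ.erase i, l j)
  have hbd : ∃ R : ℝ, 0 ≤ R ∧ ∀ w, h w ≤ h 0 → ‖w‖ ≤ R := by
    have hb : ∃ R : ℝ, 0 ≤ R ∧ ∀ i, |K i| + ‖D.y i‖ ≤ R := by
      refine ⟨∑ i, (|K i| + ‖D.y i‖), by positivity, fun i => ?_⟩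
      exact Finset.single_le_sum (f := fun i => |K i| + ‖D.y i‖) (fun i _ => by positivity)
        (Finset.mem_univ i)
    obtain ⟨R, hR, hKR⟩ := hb
    refine ⟨R, hR, fun w hw => ?_⟩
    refine (pi_norm_le_iff_of_nonneg hR).2 fun i => ?_
    have hi : auxTerm (D.lam i) (D.y i - (w i).1) (Matrix.of (w i).2)
        ≤ h 0 - ∑ j ∈ Finset.univ.erase i, l j := by
      have h1 : h w = auxTerm (D.lam i) (D.y i - (w i).1) (Matrix.of (w i).2) +
          ∑ j ∈ Finset.univ.erase i, auxTerm (D.lam j) (D.y j - (w j).1) (Matrix.of (w j).2) :=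
        (Finset.add_sum_erase Finset.univ
          (fun j => auxTerm (D.lam j) (D.y j - (w j).1) (Matrix.of (w j).2))
          (Finset.mem_univ i)).symm
      have h2 : ∑ j ∈ Finset.univ.erase i, l j ≤ ∑ j ∈ Finset.univ.erase i,
          auxTerm (D.lam j) (D.y j - (w j).1) (Matrix.of (w j).2) :=
        Finset.sum_le_sum fun j _ => hl j _ _
      linarith
    obtain ⟨ha, hb⟩ := hK i _ _ hi
    have hKi := le_abs_self (K i)
    have hi' := hKR i
    have hy := norm_nonneg (D.y i)
    refine norm_prod_le_iff.2 ⟨(pi_norm_le_iff_of_nonneg hR).2 fun a => ?_,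
      (pi_norm_le_iff_of_nonneg hR).2 fun a => (pi_norm_le_iff_of_nonneg hR).2 fun b => ?_⟩
    · have h3 := ha a
      have h4 := norm_le_pi_norm (D.y i) a
      rw [Real.norm_eq_abs] at h4 ⊢
      rw [Pi.sub_apply] at h3
      have h5 := abs_sub_abs_le_abs_sub ((w i).1 a) (D.y i a)
      rw [abs_sub_comm] at h5
      linarith
    · have h3 := hb a b
      rw [Real.norm_eq_abs]
      rw [Matrix.of_apply] at h3
      linarith
  obtain ⟨R, hR, hRw⟩ := hbd
  have hclosed : IsClosed (LinearMap.range (auxF D) : Set (∀ i, (Fin (D.n i) → ℝ) ×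
      (Fin (D.n i) → Fin q → ℝ))) := Submodule.closed_of_finiteDimensional _
  have hcomp := (isCompact_closedBall (0 : ∀ i, (Fin (D.n i) → ℝ) ×
      (Fin (D.n i) → Fin q → ℝ)) R).inter_right hclosed
  have h0 : (0 : ∀ i, (Fin (D.n i) → ℝ) × (Fin (D.n i) → Fin q → ℝ)) ∈
      Metric.closedBall 0 R ∩ (LinearMap.range (auxF D) : Set _) :=
    ⟨Metric.mem_closedBall_self hR, Submodule.zero_mem _⟩
  obtain ⟨w, ⟨_, ⟨⟨βs, Bs⟩, rfl⟩⟩, hmin⟩ := hcomp.exists_isMinOn ⟨0, h0⟩ hcont.continuousOn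
  refine ⟨βs, Matrix.of Bs * (Matrix.of Bs)ᵀ, ?_, fun β Γ hΓ => ?_⟩
  · have := posSemidef_self_mul_conjTranspose (Matrix.of Bs)
    rwa [conjTranspose_eq_transpose_of_trivial] at this
  · obtain ⟨B, hB⟩ : ∃ B : Fin q → Fin q → ℝ, Γ = Matrix.of B * (Matrix.of B)ᵀ :=
      aux_sqrt Γ hΓ
    rw [hB, ← hF, ← hF]
    rcases le_total (h (auxF D (β, B))) (h 0) with hle | hle
    · exact hmin ⟨by simpa using hRw _ hle, ⟨_, rfl⟩⟩
    · exact (hmin h0).trans hle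
end
end

section
/- Let η > η̄ and μ ≥ 0. Let R : ℝ^p × ℝ^q → ℝ_+ ∪ {+∞} be lower semicontinuous; if μ = 0 assume R is level compact, and if μ > 0 assume R is 1-coercive. Then the relaxed variable-selection problem min over ((β,γ),(β̃,γ̃)) ∈ (ℝ^p×ℝ^q) × (ℝ^p×ℝ_+^q) of L_{η,μ}((β,γ),(β̃,γ̃)) + R(β̃,γ̃) has an optimal solution (in particular its optimal value is finite). -/
open Matrix Real Filter Topology Bornology
open scoped Pointwise

noncomputable section

theorem aux_one_le_det {n : Type*} [Fintype n] [DecidableEq n] {S : Matrix n n ℝ}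
    (hS : S.PosSemidef) : 1 ≤ (1 + S).det := by
  have hH : (1 + S).IsHermitian := Matrix.isHermitian_one.add hS.1
  rw [hH.det_eq_prod_eigenvalues]
  have key : ∀ i, 1 ≤ hH.eigenvalues i := by
    intro i
    rw [hH.eigenvalues_eq]
    have h1 := hS.dotProduct_mulVec_nonneg (⇑(hH.eigenvectorBasis i))
    have h2 : star (⇑(hH.eigenvectorBasis i)) ⬝ᵥ (⇑(hH.eigenvectorBasis i)) = (1 : ℝ) := by
      have h3 := hH.eigenvectorBasis.orthonormal.1 i
      have h4 : inner ℝ (hH.eigenvectorBasis i) (hH.eigenvectorBasis i) = (1 : ℝ) := by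
        rw [real_inner_self_eq_norm_sq, h3]; norm_num
      rw [← h4, EuclideanSpace.inner_eq_star_dotProduct, dotProduct_comm]
    simp only [Matrix.add_mulVec, Matrix.one_mulVec, dotProduct_add, h2]
    simpa using h1
  have := Finset.prod_le_prod (s := Finset.univ) (f := fun _ : n => (1 : ℝ))
    (g := fun i => hH.eigenvalues i) (fun _ _ => zero_le_one) (fun i _ => key i)
  simpa using this

theorem aux_det_le {n k : ℕ} (A : Matrix (Fin n) (Fin n) ℝ) (hA : A.PosDef)
    (Z : Matrix (Fin n) (Fin k) ℝ) (g : Fin k → ℝ) (hg : ∀ j, 0 ≤ g j) :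
    A.det ≤ (Z * Matrix.diagonal g * Zᵀ + A).det := by
  set U := Z * Matrix.diagonal (fun j => Real.sqrt (g j)) with hU
  have e : Z * Matrix.diagonal g * Zᵀ + A = A + U * Uᵀ := by
    rw [hU, Matrix.transpose_mul, Matrix.diagonal_transpose, add_comm]
    congr 1
    rw [Matrix.mul_assoc Z _ (_ * _), ← Matrix.mul_assoc (Matrix.diagonal _) (Matrix.diagonal _),
      Matrix.diagonal_mul_diagonal, ← Matrix.mul_assoc]
    congr 3
    ext j
    exact (Real.mul_self_sqrt (hg j)).symm
  rw [e, Matrix.det_add_mul _ _ (hA.det_pos.ne'.isUnit)]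
  have hS : (Uᵀ * A⁻¹ * U).PosSemidef := by
    have := hA.inv.posSemidef.conjTranspose_mul_mul_same U
    rwa [Matrix.conjTranspose_eq_transpose_of_trivial] at this
  exact le_mul_of_one_le_right hA.det_pos.le (aux_one_le_det hS)

namespace LMEData
variable {m p q : ℕ}

theorem aux_Omega_posDef (D : LMEData m p q) (hlam : ∀ i, (D.lam i).PosDef) (g : Vec q)
    (hg : ∀ j, 0 ≤ g j) (i : Fin m) : (D.Omega (Matrix.diagonal g) i).PosDef := by
  unfold Omega
  refine Matrix.PosDef.posSemidef_add ?_ (hlam i)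
  have := (Matrix.PosSemidef.diagonal (n := Fin q) (d := g) hg).mul_mul_conjTranspose_same (D.Z i)
  rwa [Matrix.conjTranspose_eq_transpose_of_trivial] at this

theorem aux_L_lower (D : LMEData m p q) (hlam : ∀ i, (D.lam i).PosDef) :
    ∃ C : ℝ, ∀ b : Vec p, ∀ g : Vec q, (∀ j, 0 ≤ g j) → C ≤ D.L b g := by
  refine ⟨∑ i, (1 : ℝ) / 2 * Real.log (D.lam i).det, fun b g hg => ?_⟩
  unfold L LML
  refine Finset.sum_le_sum fun i _ => ?_
  have h1 := (D.aux_Omega_posDef hlam g hg i).inv.posSemidef.dotProduct_mulVec_nonneg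
    (D.y i - D.X i *ᵥ b)
  have h2 : Real.log (D.lam i).det ≤ Real.log (D.Omega (Matrix.diagonal g) i).det :=
    Real.log_le_log (hlam i).det_pos (aux_det_le _ (hlam i) (D.Z i) g hg)
  rw [star_trivial] at h1
  linarith

theorem aux_L_cont (D : LMEData m p q) (hlam : ∀ i, (D.lam i).PosDef) (x : Vec p × Vec q)
    (hx : ∀ j, 0 ≤ x.2 j) : ContinuousAt (fun z : Vec p × Vec q => D.L z.1 z.2) x := by
  unfold L LML
  refine tendsto_finsetSum _ fun i _ => ?_
  have hO : Continuous (fun z : Vec p × Vec q => D.Omega (Matrix.diagonal z.2) i) := by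
    unfold Omega; fun_prop
  have hd := (D.aux_Omega_posDef hlam x.2 hx i).det_pos.ne'
  have hI : ContinuousAt (fun z : Vec p × Vec q => (D.Omega (Matrix.diagonal z.2) i)⁻¹) x := by
    refine ContinuousAt.comp (f := fun z : Vec p × Vec q => D.Omega (Matrix.diagonal z.2) i)
      (continuousAt_matrix_inv _ ?_) hO.continuousAt
    have : (Ring.inverse : ℝ → ℝ) = Inv.inv := by ext; simp
    rw [this]
    exact continuousAt_inv₀ hd
  have hv : Continuous (fun z : Vec p × Vec q => D.y i - D.X i *ᵥ z.1) := by fun_prop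
  have hdot : Continuous (fun t : Matrix (Fin (D.n i)) (Fin (D.n i)) ℝ × (Fin (D.n i) → ℝ) =>
    t.2 ⬝ᵥ (t.1 *ᵥ t.2)) := by fun_prop
  have h1 := ContinuousAt.comp (f := fun z : Vec p × Vec q =>
    ((D.Omega (Matrix.diagonal z.2) i)⁻¹, D.y i - D.X i *ᵥ z.1)) (x := x)
    hdot.continuousAt (hI.prodMk hv.continuousAt)
  have h2 : ContinuousAt (fun z : Vec p × Vec q =>
      Real.log (D.Omega (Matrix.diagonal z.2) i).det) x :=
    ContinuousAt.log hO.matrix_det.continuousAt hd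
  exact (h1.const_mul _).add (h2.const_mul _)

theorem aux_etabar_nonneg (D : LMEData m p q) : 0 ≤ D.etabar := by
  unfold etabar nu
  refine mul_nonneg (Real.iSup_nonneg fun i => ?_) (Nat.cast_nonneg _)
  positivity

/-- real part of the relaxed objective -/
def auxH (D : LMEData m p q) (η μ : ℝ) (z : (Vec p × Vec q) × (Vec p × Vec q)) : ℝ :=
  (D.L z.1.1 z.1.2 + kappaFun η (z.1 - z.2)) + (-μ) * ∑ j, Real.log (z.1.2 j / μ)

/-- domain of the barrier -/
def auxDom (μ : ℝ) {q : ℕ} (g : Vec q) : Prop := (∀ j, 0 ≤ g j) ∧ (0 < μ → ∀ j, 0 < g j)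

theorem aux_Lrelax_dom (D : LMEData m p q) (η μ : ℝ) (hμ : 0 ≤ μ) (x w : Vec p × Vec q)
    (h : auxDom μ x.2) : D.Lrelax η μ x w = (D.auxH η μ (x, w) : EReal) := by
  unfold Lrelax auxH phiBar
  rcases hμ.eq_or_lt with h0 | h0
  · subst h0; simp [h.1]
  · rw [if_neg h0.ne', if_pos h0, if_pos (h.2 h0)]
    simp only [EReal.coe_add]

theorem aux_Lrelax_not_dom (D : LMEData m p q) (η μ : ℝ) (hμ : 0 ≤ μ) (x w : Vec p × Vec q)
    (h : ¬ auxDom μ x.2) : D.Lrelax η μ x w = ⊤ := by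
  unfold Lrelax phiBar
  rcases hμ.eq_or_lt with h0 | h0
  · subst h0
    rw [if_pos rfl, if_neg (fun h' => h ⟨h', fun h0 => absurd h0 (lt_irrefl _)⟩)]
    exact EReal.coe_add_top _
  · rw [if_neg h0.ne', if_pos h0, if_neg (fun h' => h ⟨fun j => (h' j).le, fun _ => h'⟩)]
    exact EReal.coe_add_top _

theorem aux_H_cont (D : LMEData m p q) (hlam : ∀ i, (D.lam i).PosDef) (η μ : ℝ) (hμ : 0 ≤ μ)
    (z : (Vec p × Vec q) × (Vec p × Vec q)) (h : auxDom μ z.1.2) :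
    ContinuousAt (D.auxH η μ) z := by
  unfold auxH
  have h1 : ContinuousAt (fun z : (Vec p × Vec q) × (Vec p × Vec q) => D.L z.1.1 z.1.2) z :=
    ContinuousAt.comp (f := Prod.fst) (D.aux_L_cont hlam z.1 h.1) continuousAt_fst
  have h2 : Continuous (fun z : (Vec p × Vec q) × (Vec p × Vec q) => kappaFun η (z.1 - z.2)) := by
    unfold kappaFun sqnorm2; fun_prop
  refine (h1.add h2.continuousAt).add ?_
  rcases hμ.eq_or_lt with h0 | h0
  · subst h0; simp only [neg_zero, zero_mul]; exact continuousAt_const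
  · refine ContinuousAt.const_mul ?_ _
    refine tendsto_finsetSum _ fun j _ => ?_
    refine ContinuousAt.log (by fun_prop) (div_pos (h.2 h0 j) h0).ne'

end LMEData

theorem aux_sqnorm2_nonneg {p q : ℕ} (w : Vec p × Vec q) : 0 ≤ sqnorm2 w := by
  unfold sqnorm2; positivity

theorem aux_norm_le {p q : ℕ} (w : Vec p × Vec q) : ‖w‖ ≤ Real.sqrt (sqnorm2 w) := by
  have h1 : 0 ≤ ∑ j, (w.1 j) ^ 2 := by positivity
  have h2 : 0 ≤ ∑ j, (w.2 j) ^ 2 := by positivity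
  rw [Prod.norm_def]
  refine max_le ?_ ?_
  · refine (pi_norm_le_iff_of_nonneg (Real.sqrt_nonneg _)).2 fun j => ?_
    refine Real.abs_le_sqrt ?_
    have := Finset.single_le_sum (f := fun j => (w.1 j) ^ 2) (fun i _ => sq_nonneg _)
      (Finset.mem_univ j)
    unfold sqnorm2; linarith
  · refine (pi_norm_le_iff_of_nonneg (Real.sqrt_nonneg _)).2 fun j => ?_
    refine Real.abs_le_sqrt ?_
    have := Finset.single_le_sum (f := fun j => (w.2 j) ^ 2) (fun i _ => sq_nonneg _)
      (Finset.mem_univ j)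
    unfold sqnorm2; linarith

theorem aux_le_norm {p q : ℕ} (w : Vec p × Vec q) (j : Fin q) : |w.2 j| ≤ ‖w‖ :=
  (norm_le_pi_norm w.2 j).trans (norm_snd_le w)

theorem aux_neg_log_lower (μ d : ℝ) (hμ : 0 < μ) (hd : 0 < d) (q : ℕ) :
    ∃ C : ℝ, ∀ g : Vec q, (∀ j, 0 < g j) → ∀ s, (∀ j, g j ≤ s) → 0 ≤ s →
      -(d * s) - C ≤ (-μ) * ∑ j, Real.log (g j / μ) := by
  -- log (g/μ) ≤ a g + C₁, a = d / (μ (q+1))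
  set a : ℝ := d / (μ * (q + 1)) with ha
  have ha0 : 0 < a := by positivity
  set C1 : ℝ := |Real.log (a * μ)| with hC1
  refine ⟨μ * (q * C1), fun g hg s hs hs0 => ?_⟩
  have hle : ∀ j, Real.log (g j / μ) ≤ a * s + C1 := by
    intro j
    have h1 : Real.log (g j / μ) = Real.log (a * g j) - Real.log (a * μ) := by
      rw [← Real.log_div (by have := hg j; positivity) (by positivity)]
      congr 1
      field_simp
    have h2 := Real.log_le_sub_one_of_pos (mul_pos ha0 (hg j))
    have h3 := mul_le_mul_of_nonneg_left (hs j) ha0.le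
    have h4 := neg_abs_le (Real.log (a * μ))
    rw [h1]; linarith
  have hsum : ∑ j, Real.log (g j / μ) ≤ q * (a * s + C1) := by
    have := Finset.sum_le_card_nsmul Finset.univ (fun j => Real.log (g j / μ)) _ (fun j _ => hle j)
    simpa [mul_add] using this
  have h5 : μ * (q * a) ≤ d := by
    rw [ha]
    have : μ * (q * (d / (μ * (q + 1)))) = d * (q / (q + 1)) := by field_simp
    rw [this]
    have : (q : ℝ) / (q + 1) ≤ 1 := by rw [div_le_one (by positivity)]; linarith
    nlinarith
  have h6 := mul_le_mul_of_nonneg_left hsum hμ.le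
  have h7 := mul_le_mul_of_nonneg_right h5 hs0
  nlinarith

theorem aux_pos_lower (μ C M : ℝ) (hμ : 0 < μ) (hM : 0 ≤ M) (q : ℕ) :
    ∃ e : ℝ, 0 < e ∧ ∀ g : Vec q, (∀ j, 0 < g j) → (∀ j, g j ≤ M) →
      (-μ) * ∑ j, Real.log (g j / μ) ≤ C → ∀ j, e ≤ g j := by
  refine ⟨μ * Real.exp (-(C / μ) - q * (M / μ)), by positivity, fun g hg hgM hC j => ?_⟩
  have h1 : ∑ k ∈ Finset.univ.erase j, Real.log (g k / μ) ≤ q * (M / μ) := by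
    have hle : ∀ k ∈ Finset.univ.erase j, Real.log (g k / μ) ≤ M / μ := fun k _ => by
      have := Real.log_le_sub_one_of_pos (div_pos (hg k) hμ)
      have h3 : g k / μ ≤ M / μ := by gcongr; exact hgM k
      linarith
    have h2 := Finset.sum_le_card_nsmul _ _ _ hle
    refine h2.trans ?_
    rw [nsmul_eq_mul]
    have : ((Finset.univ.erase j).card : ℝ) ≤ q := by
      exact_mod_cast (Finset.card_le_univ _).trans (by simp)
    exact mul_le_mul_of_nonneg_right this (by positivity)
  have h2 := Finset.add_sum_erase Finset.univ (fun k => Real.log (g k / μ)) (Finset.mem_univ j)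
  have h3 : -(C / μ) ≤ ∑ k, Real.log (g k / μ) := by
    rw [← neg_div, div_le_iff₀ hμ]; linarith
  have h4 : -(C / μ) - q * (M / μ) ≤ Real.log (g j / μ) := by linarith
  have h5 := (Real.le_log_iff_exp_le (div_pos (hg j) hμ)).1 h4
  rw [le_div_iff₀ hμ] at h5
  linarith

/-- boundedness of sublevel sets -/
theorem aux_bounded {m p q : ℕ} 
    (D : LMEData m p q) (hlam : ∀ i, (D.lam i).PosDef)
    (μ η : ℝ) (hμ : 0 ≤ μ) (hη : 0 < η)
    (R : Vec p × Vec q → EReal)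
    (hR0case : μ = 0 → ∀ c : ℝ, IsCompact {w : Vec p × Vec q | R w ≤ (c : EReal)})
    (hRpos : 0 < μ → OneCoercive R) (c : ℝ) :
    ∃ e M : ℝ, 0 ≤ e ∧ (0 < μ → 0 < e) ∧ ∀ x w : Vec p × Vec q, ∀ r : ℝ, 0 ≤ r → R w = (r : EReal) →
      LMEData.auxDom μ x.2 → D.auxH η μ (x, w) + r ≤ c →
      ‖x‖ ≤ M ∧ ‖w‖ ≤ M ∧ ∀ j, e ≤ x.2 j := by
  obtain ⟨CL, hCL⟩ := D.aux_L_lower hlam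
  rcases hμ.eq_or_lt with h0 | h0
  · subst h0
    obtain ⟨B, hB⟩ := (hR0case rfl (c - CL)).isBounded.exists_norm_le
    refine ⟨0, max B 0 + Real.sqrt (2 / η * (c - CL)), le_rfl, fun h => absurd h (lt_irrefl _), ?_⟩
    intro x w r hr hRr hdom hle
    have hL := hCL x.1 x.2 hdom.1
    have hs := aux_sqnorm2_nonneg (x - w)
    have hk : 0 ≤ η / 2 * sqnorm2 (x - w) := by positivity
    simp only [LMEData.auxH, kappaFun, neg_zero, zero_mul, add_zero] at hle
    have hw : ‖w‖ ≤ B := hB w (by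
      rw [Set.mem_setOf_eq, hRr]; exact EReal.coe_le_coe_iff.2 (by linarith))
    have hxw : ‖x - w‖ ≤ Real.sqrt (2 / η * (c - CL)) := by
      refine (aux_norm_le _).trans (Real.sqrt_le_sqrt ?_)
      rw [div_mul_eq_mul_div, le_div_iff₀ hη]
      linarith
    have htri : ‖x‖ ≤ ‖x - w‖ + ‖w‖ := by
      simpa using norm_add_le (x - w) w
    have := le_max_left B 0
    have := Real.sqrt_nonneg (2 / η * (c - CL))
    exact ⟨by linarith, by linarith, hdom.1⟩
  · obtain ⟨a, ha, ρ, hρ⟩ := hRpos h0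
    obtain ⟨C2, hC2⟩ := aux_neg_log_lower μ (a / 2) h0 (by positivity) q
    -- total bound
    set T : ℝ := 2 / a * (c - CL + a * |ρ| + a ^ 2 / (2 * η) + C2) with hT
    set M : ℝ := max T 0 with hM
    obtain ⟨e, he, hepos⟩ := aux_pos_lower μ (c - CL) M h0 (le_max_right _ _) q
    refine ⟨e, M, he.le, fun _ => he, ?_⟩
    intro x w r hr hRr hdom hle
    have hL := hCL x.1 x.2 hdom.1
    simp only [LMEData.auxH, kappaFun] at hle
    set s := Real.sqrt (sqnorm2 (x - w)) with hs
    have hs0 : 0 ≤ s := Real.sqrt_nonneg _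
    have hss : sqnorm2 (x - w) = s ^ 2 := (Real.sq_sqrt (aux_sqnorm2_nonneg _)).symm
    have hxw : ‖x - w‖ ≤ s := aux_norm_le _
    set b := Real.sqrt (sqnorm2 w) with hb
    have hb0 : 0 ≤ b := Real.sqrt_nonneg _
    have hw : ‖w‖ ≤ b := aux_norm_le _
    have htri : ‖x‖ ≤ ‖x - w‖ + ‖w‖ := by
      simpa using norm_add_le (x - w) w
    have hr' : a * b - a * |ρ| ≤ r := by
      by_cases hc : ρ ≤ b
      · have h1 := hρ w hc
        rw [hRr] at h1
        have h2 := EReal.coe_le_coe_iff.1 h1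
        have : 0 ≤ a * |ρ| := by positivity
        linarith
      · have h1 : b ≤ |ρ| := (not_le.1 hc).le.trans (le_abs_self ρ)
        have := mul_le_mul_of_nonneg_left h1 ha.le
        linarith
    have hk : a * s - a ^ 2 / (2 * η) ≤ η / 2 * s ^ 2 := by
      have : η / 2 * s ^ 2 - (a * s - a ^ 2 / (2 * η)) = η / 2 * (s - a / η) ^ 2 := by
        field_simp
        ring
      have h2 : 0 ≤ η / 2 * (s - a / η) ^ 2 := by positivity
      linarith
    have hphi := hC2 x.2 (hdom.2 h0) (s + b) (fun j => by
      have := (le_abs_self _).trans (aux_le_norm x j)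
      linarith) (by positivity)
    rw [hss] at hle
    have htot : s + b ≤ T := by
      rw [hT, div_mul_eq_mul_div, le_div_iff₀ ha]
      nlinarith
    have hTM : T ≤ M := le_max_left _ _
    refine ⟨by linarith, by linarith, ?_⟩
    refine hepos x.2 (hdom.2 h0) (fun j => ?_) ?_
    · have := (le_abs_self _).trans (aux_le_norm x j)
      linarith
    · have : 0 ≤ η / 2 * s ^ 2 := by positivity
      linarith

/-- Existence of an optimal solution to the relaxed variable-selection
problem, with finite optimal value. -/
theorem relaxed_problem_has_solution
    {m p q : ℕ} (hm : 0 < m) (hp : 0 < p) (hq : 0 < q)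
    (D : LMEData m p q) (hn : ∀ i, 0 < D.n i) (hlam : ∀ i, (D.lam i).PosDef)
    (μ η : ℝ) (hμ : 0 ≤ μ) (hη : D.etabar < η)
    (R : Vec p × Vec q → EReal) (hR0 : ∀ w, 0 ≤ R w)
    (hRlsc : LowerSemicontinuous R)
    (hRproper : ∃ w : Vec p × Vec q, (∀ j, 0 ≤ w.2 j) ∧ R w ≠ ⊤)
    (hR0case : μ = 0 → ∀ c : ℝ, IsCompact {w : Vec p × Vec q | R w ≤ (c : EReal)})
    (hRpos : 0 < μ → OneCoercive R) :
    ∃ x w : Vec p × Vec q, (∀ j, 0 ≤ w.2 j) ∧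
      D.Lrelax η μ x w + R w ≠ ⊤ ∧ D.Lrelax η μ x w + R w ≠ ⊥ ∧
      ∀ x' w' : Vec p × Vec q, (∀ j, 0 ≤ w'.2 j) →
        D.Lrelax η μ x w + R w ≤ D.Lrelax η μ x' w' + R w' := by
  have hη0 : 0 < η := D.aux_etabar_nonneg.trans_lt hη
  -- finite objective: values at points of finite objective
  have hbot : ∀ w, R w ≠ ⊥ := fun w h => by
    have := hR0 w
    rw [h] at this
    exact absurd this (by simp)
  obtain ⟨w0, hw0, hRw0⟩ := hRproper
  set x0 : Vec p × Vec q := (0, fun _ => 1) with hx0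
  have hd0 : LMEData.auxDom μ x0.2 := ⟨fun _ => zero_le_one, fun _ _ => zero_lt_one⟩
  obtain ⟨r0, hr0⟩ : ∃ r : ℝ, R w0 = (r : EReal) :=
    ⟨(R w0).toReal, (EReal.coe_toReal hRw0 (hbot _)).symm⟩
  set c : ℝ := D.auxH η μ (x0, w0) + r0 with hc
  have hF0 : D.Lrelax η μ x0 w0 + R w0 = (c : EReal) := by
    rw [D.aux_Lrelax_dom η μ hμ x0 w0 hd0, hr0, hc, EReal.coe_add]
  obtain ⟨e, M, he0, hepos, hbd⟩ := aux_bounded D hlam μ η hμ hη0 R hR0case hRpos c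
  set K : Set ((Vec p × Vec q) × (Vec p × Vec q)) :=
    Metric.closedBall 0 M ∩ {z | (∀ j, e ≤ z.1.2 j) ∧ (∀ j, 0 ≤ z.2.2 j)} with hK
  have hKcomp : IsCompact K := by
    refine (isCompact_closedBall _ _).inter_right ?_
    refine IsClosed.and ?_ ?_
    · rw [show {z : (Vec p × Vec q) × (Vec p × Vec q) | ∀ j, e ≤ z.1.2 j}
        = ⋂ j, {z | e ≤ z.1.2 j} by ext; simp]
      exact isClosed_iInter fun j => isClosed_le continuous_const (by fun_prop)
    · rw [show {z : (Vec p × Vec q) × (Vec p × Vec q) | ∀ j, 0 ≤ z.2.2 j}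
        = ⋂ j, {z | 0 ≤ z.2.2 j} by ext; simp]
      exact isClosed_iInter fun j => isClosed_le continuous_const (by fun_prop)
  have hKdom : ∀ z ∈ K, LMEData.auxDom μ z.1.2 := fun z hz =>
    ⟨fun j => he0.trans (hz.2.1 j), fun h j => (hepos h).trans_le (hz.2.1 j)⟩
  -- sublevel points lie in K
  have hsub : ∀ x w : Vec p × Vec q, (∀ j, 0 ≤ w.2 j) →
      D.Lrelax η μ x w + R w ≤ (c : EReal) → (x, w) ∈ K := by
    intro x w hw hle
    have hd : LMEData.auxDom μ x.2 := by
      by_contra h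
      rw [D.aux_Lrelax_not_dom η μ hμ x w h, EReal.top_add_of_ne_bot (hbot w)] at hle
      exact absurd hle (by simp)
    rw [D.aux_Lrelax_dom η μ hμ x w hd] at hle
    have hRtop : R w ≠ ⊤ := by
      intro h
      rw [h, EReal.coe_add_top] at hle
      exact absurd hle (by simp)
    obtain ⟨r, hr⟩ : ∃ r : ℝ, R w = (r : EReal) :=
      ⟨(R w).toReal, (EReal.coe_toReal hRtop (hbot _)).symm⟩
    have hr0 : 0 ≤ r := by
      have := hR0 w
      rw [hr] at this
      exact_mod_cast this
    rw [hr] at hle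
    have hle' : D.auxH η μ (x, w) + r ≤ c := by exact_mod_cast hle
    obtain ⟨h1, h2, h3⟩ := hbd x w r hr0 hr hd hle'
    refine ⟨?_, h3, hw⟩
    rw [mem_closedBall_zero_iff, Prod.norm_def]
    exact max_le h1 h2
  have hmem0 : (x0, w0) ∈ K := hsub x0 w0 hw0 hF0.le
  have hlsc : LowerSemicontinuousOn
      (fun z : (Vec p × Vec q) × (Vec p × Vec q) => (D.auxH η μ z : EReal) + R z.2) K := by
    refine LowerSemicontinuousOn.add' ?_ ?_ ?_
    · refine ContinuousOn.lowerSemicontinuousOn fun z hz => ?_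
      exact (continuous_coe_real_ereal.continuousAt.comp
        (D.aux_H_cont hlam η μ hμ z (hKdom z hz))).continuousWithinAt
    · exact (hRlsc.comp continuous_snd).lowerSemicontinuousOn _
    · intro z _
      exact EReal.continuousAt_add (Or.inl (EReal.coe_ne_top _)) (Or.inl (EReal.coe_ne_bot _))
  obtain ⟨z, hzK, hzmin⟩ := LowerSemicontinuousOn.exists_isMinOn ⟨_, hmem0⟩ hKcomp hlsc
  have hval : ∀ z ∈ K, D.Lrelax η μ z.1 z.2 + R z.2 = (D.auxH η μ z : EReal) + R z.2 :=
    fun z hz => by rw [D.aux_Lrelax_dom η μ hμ z.1 z.2 (hKdom z hz)]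
  have hmin : ∀ z' ∈ K, D.Lrelax η μ z.1 z.2 + R z.2 ≤ D.Lrelax η μ z'.1 z'.2 + R z'.2 := by
    intro z' hz'
    rw [hval z hzK, hval z' hz']
    exact hzmin hz'
  have hzc : D.Lrelax η μ z.1 z.2 + R z.2 ≤ (c : EReal) := (hmin _ hmem0).trans hF0.le
  refine ⟨z.1, z.2, hzK.2.2, ?_, ?_, ?_⟩
  · exact (hzc.trans_lt (EReal.coe_lt_top c)).ne
  · rw [hval z hzK]
    simp [EReal.add_eq_bot_iff, hbot]
  · intro x' w' hw'
    by_cases h : D.Lrelax η μ x' w' + R w' ≤ (c : EReal)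
    · exact hmin (x', w') (hsub x' w' hw' h)
    · exact hzc.trans (not_le.1 h).le
end
end
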